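/- (MAML solution for quadratic losses.) For i = 1, …, M let f_i(w) = (1/2) wᵀA_i w + wᵀb_i with each A_i symmetric positive definite, b_i ∈ ℝ^d, and let U_i(w) = w − α(A_i w + b_i). Suppose 0 < α and α λ_max(A_i) < 1 for every i. Define A_† = (1/M) Σ_{i=1}^M (I − αA_i)² A_i and b_† = (1/M) Σ_{i=1}^M (I − αA_i)² b_i. Then A_† is symmetric positive definite, and the MAML objective F̃(w) = (1/M) Σ_{i=1}^M f_i(U_i(w)) attains its unique global minimum at w* = −A_†⁻¹ b_†. -/

import Mathlib

open scoped Matrix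

open Matrix

/-- `1 - α • A` is invertible when `α⁻¹` is not in the spectrum of `A`. -/
lemma isUnit_one_sub_smul {n : Type*} [Fintype n] [DecidableEq n] {A : Matrix n n ℝ} {α : ℝ}
    (hα : α ≠ 0) (h : α⁻¹ ∉ spectrum ℝ A) : IsUnit (1 - α • A) := by
  rw [spectrum.notMem_iff, Algebra.algebraMap_eq_smul_one] at h
  have h' := h.smul (Units.mk0 α hα)
  rwa [Units.smul_def, Units.val_mk0, smul_sub, smul_smul, mul_inv_cancel₀ hα, one_smul] at h'

lemma isHermitian_one_sub_smul {n : Type*} [DecidableEq n] {A : Matrix n n ℝ}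
    (hA : A.IsHermitian) (α : ℝ) : (1 - α • A).IsHermitian := by
  rw [IsHermitian, conjTranspose_sub, conjTranspose_smul, conjTranspose_one, hA.eq, star_trivial]

lemma one_sub_smul_sq_mul {n : Type*} [Fintype n] [DecidableEq n] (A : Matrix n n ℝ) (α : ℝ) :
    (1 - α • A) ^ 2 * A = (1 - α • A) * A * (1 - α • A) := by
  have : Commute (1 - α • A) A :=
    (Commute.one_left A).sub_left ((Commute.refl A).smul_left α)
  rw [pow_two, mul_assoc, mul_assoc, this.eq]

lemma posDef_one_sub_smul_sq_mul {n : Type*} [Fintype n] [DecidableEq n] {A : Matrix n n ℝ}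
    {α : ℝ} (hA : A.PosDef) (hu : IsUnit (1 - α • A)) : ((1 - α • A) ^ 2 * A).PosDef := by
  have h := hA.conjTranspose_mul_mul_same (mulVec_injective_of_isUnit hu)
  rwa [(isHermitian_one_sub_smul hA.isHermitian α).eq, ← one_sub_smul_sq_mul] at h

/-- Exact second-order expansion of a quadratic function. -/
lemma quadratic_add {n : Type*} [Fintype n] {A : Matrix n n ℝ} (hA : A.IsHermitian)
    (b v h : n → ℝ) :
    (1 / 2 : ℝ) * ((v + h) ⬝ᵥ A *ᵥ (v + h)) + (v + h) ⬝ᵥ b =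
      (1 / 2 * (v ⬝ᵥ A *ᵥ v) + v ⬝ᵥ b) + h ⬝ᵥ (A *ᵥ v + b) + 1 / 2 * (h ⬝ᵥ A *ᵥ h) := by
  have hs : v ⬝ᵥ A *ᵥ h = h ⬝ᵥ A *ᵥ v := by
    have hT : Aᵀ = A := by simpa [IsHermitian] using hA
    rw [dotProduct_mulVec, ← mulVec_transpose, hT, dotProduct_comm]
  simp only [mulVec_add, add_dotProduct, dotProduct_add, hs]
  ring

/-- Exact second-order expansion of a quadratic function after one gradient step. -/
lemma quadratic_gradient_step_add {n : Type*} [Fintype n] [DecidableEq n] {A : Matrix n n ℝ}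
    (hA : A.IsHermitian) (α : ℝ) (b v h : n → ℝ) (U : (n → ℝ) → n → ℝ)
    (hU : ∀ w, U w = w - α • (A *ᵥ w + b)) :
    (1 / 2 : ℝ) * (U (v + h) ⬝ᵥ A *ᵥ U (v + h)) + U (v + h) ⬝ᵥ b =
      (1 / 2 * (U v ⬝ᵥ A *ᵥ U v) + U v ⬝ᵥ b) +
        h ⬝ᵥ (((1 - α • A) ^ 2 * A) *ᵥ v + (1 - α • A) ^ 2 *ᵥ b) +
        1 / 2 * (h ⬝ᵥ ((1 - α • A) ^ 2 * A) *ᵥ h) := by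
  have hB : (1 - α • A)ᵀ = 1 - α • A := by
    simpa [IsHermitian] using isHermitian_one_sub_smul hA α
  have hUadd : U (v + h) = U v + (1 - α • A) *ᵥ h := by
    simp only [hU, mulVec_add, sub_mulVec, one_mulVec, smul_mulVec, smul_add]
    abel
  have hself (x y : n → ℝ) : ((1 - α • A) *ᵥ x) ⬝ᵥ y = x ⬝ᵥ (1 - α • A) *ᵥ y := by
    rw [dotProduct_mulVec, ← mulVec_transpose, hB]
  have hgrad : A *ᵥ U v + b = (1 - α • A) *ᵥ (A *ᵥ v + b) := by
    simp only [hU, mulVec_add, mulVec_sub, mulVec_smul, sub_mulVec, one_mulVec, smul_mulVec,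
      smul_add]
    abel
  rw [hUadd, quadratic_add hA, hself, hself, hgrad, mulVec_mulVec, mulVec_mulVec, mulVec_mulVec,
    ← one_sub_smul_sq_mul, ← pow_two, mulVec_add, mulVec_mulVec]

/-- **MAML solution for quadratic losses.**
For quadratics `fᵢ(w) = (1/2) wᵀ Aᵢ w + wᵀ bᵢ` with `Aᵢ` symmetric positive definite and
one-step updates `Uᵢ(w) = w - α (Aᵢ w + bᵢ)`, if `0 < α` and `α λ < 1` for every eigenvalue
`λ` of every `Aᵢ` (i.e. `α λ_max(Aᵢ) < 1`), then
`A† = (1/M) ∑ᵢ (I - αAᵢ)² Aᵢ` is symmetric positive definite and the MAML objective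
`F̃(w) = (1/M) ∑ᵢ fᵢ(Uᵢ(w))` attains its unique global minimum at `w* = -A†⁻¹ b†`,
where `b† = (1/M) ∑ᵢ (I - αAᵢ)² bᵢ`. -/
theorem maml_quadratic_solution
    (d M : ℕ) (hM : 0 < M) (α : ℝ) (hα : 0 < α)
    (A : Fin M → Matrix (Fin d) (Fin d) ℝ) (b : Fin M → Fin d → ℝ)
    (hA : ∀ i, (A i).PosDef)
    (hspec : ∀ i, ∀ lam ∈ spectrum ℝ (A i), α * lam < 1)
    (Adag : Matrix (Fin d) (Fin d) ℝ)
    (hAdag : Adag = (M : ℝ)⁻¹ • ∑ i, (1 - α • A i) ^ 2 * A i)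
    (bdag : Fin d → ℝ)
    (hbdag : bdag = (M : ℝ)⁻¹ • ∑ i, ((1 - α • A i) ^ 2).mulVec (b i))
    (U : Fin M → (Fin d → ℝ) → (Fin d → ℝ))
    (hU : U = fun i w => w - α • ((A i).mulVec w + b i))
    (F : (Fin d → ℝ) → ℝ)
    (hF : F = fun w => (M : ℝ)⁻¹ *
      ∑ i, ((1 / 2 : ℝ) * (U i w ⬝ᵥ (A i).mulVec (U i w)) + U i w ⬝ᵥ b i)) :
    Adag.PosDef ∧
    (∀ w, F (-(Adag⁻¹.mulVec bdag)) ≤ F w) ∧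
    (∀ w, F w = F (-(Adag⁻¹.mulVec bdag)) → w = -(Adag⁻¹.mulVec bdag)) := by
  have : NeZero M := ⟨hM.ne'⟩
  have hMpos : (0 : ℝ) < (M : ℝ)⁻¹ := by positivity
  have hunit (i : Fin M) : IsUnit (1 - α • A i) :=
    isUnit_one_sub_smul hα.ne' fun h => by
      simpa [mul_inv_cancel₀ hα.ne'] using hspec i _ h
  have hpos : Adag.PosDef := by
    rw [hAdag]
    exact (posDef_sum Finset.univ_nonempty
      fun i _ => posDef_one_sub_smul_sq_mul (hA i) (hunit i)).smul hMpos
  have hexp (v h : Fin d → ℝ) :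
      F (v + h) = F v + h ⬝ᵥ (Adag *ᵥ v + bdag) + 1 / 2 * (h ⬝ᵥ Adag *ᵥ h) := by
    have hstep (i : Fin M) := quadratic_gradient_step_add (hA i).isHermitian α (b i) v h (U i)
      fun w => by rw [hU]
    simp only [hF, hstep]
    simp only [hAdag, hbdag, Finset.sum_add_distrib, smul_mulVec, sum_mulVec,
      dotProduct_add, dotProduct_smul, dotProduct_sum, smul_eq_mul, ← Finset.mul_sum]
    ring
  set v := -(Adag⁻¹ *ᵥ bdag) with hv
  have hcrit : Adag *ᵥ v + bdag = 0 := by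
    rw [hv, mulVec_neg, mulVec_mulVec,
      mul_nonsing_inv _ ((isUnit_iff_isUnit_det _).mp hpos.isUnit), one_mulVec, neg_add_cancel]
  have hval (w : Fin d → ℝ) : F w = F v + 1 / 2 * ((w - v) ⬝ᵥ Adag *ᵥ (w - v)) := by
    simpa [hcrit] using hexp v (w - v)
  refine ⟨hpos, fun w => ?_, fun w hw => ?_⟩
  · have h := hpos.posSemidef.dotProduct_mulVec_nonneg (w - v)
    rw [star_trivial] at h
    linarith [hval w]
  · by_contra hne
    have h := hpos.dotProduct_mulVec_pos (sub_ne_zero.mpr hne)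
    rw [star_trivial] at h
    linarith [hval w]
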